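/- The mechanism A^{F*} satisfies participation: for every integer n ≥ 2, every (n−1)-voter preference profile P_{-i}, and every budget division p_i, d(A^{F*}_n(p_i, P_{-i}), p_i) ≤ d(A^{F*}_{n−1}(P_{-i}), p_i), where A^{F*}_k denotes the moving phantom mechanism for k voters defined by the phantom system F* for k voters. -/

import Mathlib

open Finset

/-- `p` is a budget division over `m` alternatives: entries in `[0,1]` summing to `1`. -/
def IsDivision {m : ℕ} (p : Fin m → ℝ) : Prop :=
  (∀ j, p j ∈ Set.Icc (0 : ℝ) 1) ∧ ∑ j, p j = 1

/-- A valid preference profile: every voter reports a budget division. -/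
def IsProfile {n m : ℕ} (P : Fin n → Fin m → ℝ) : Prop :=
  ∀ i, IsDivision (P i)

/-- The ℓ1 distance between two vectors. -/
noncomputable def l1 {m : ℕ} (x y : Fin m → ℝ) : ℝ := ∑ j, |x j - y j|

/-- Median of a list of odd length `2k+1`: its `(k+1)`-st smallest element. -/
noncomputable def medList (l : List ℝ) : ℝ :=
  ((Multiset.ofList l).sort (· ≤ ·)).getD ((l.length - 1) / 2) 0

/-- Coordinate-wise generalized median on alternative `j`, with phantoms `f k t` and
the voters' reports on alternative `j`. -/
noncomputable def phMed {n m : ℕ} (f : Fin (n + 1) → ℝ → ℝ)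
    (P : Fin n → Fin m → ℝ) (t : ℝ) (j : Fin m) : ℝ :=
  medList (List.ofFn (fun k => f k t) ++ List.ofFn (fun i => P i j))

/-- A phantom system for `n` voters: `n+1` continuous, weakly increasing functions
`[0,1] → [0,1]` with `f k 0 = 0`, `f k 1 = 1`, ordered `f 0 ≥ f 1 ≥ ⋯ ≥ f n`. -/
structure IsPhantomSystem (n : ℕ) (f : Fin (n + 1) → ℝ → ℝ) : Prop where
  cont : ∀ k, ContinuousOn (f k) (Set.Icc 0 1)
  mono : ∀ k, MonotoneOn (f k) (Set.Icc 0 1)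
  mem_Icc : ∀ k, ∀ t ∈ Set.Icc (0 : ℝ) 1, f k t ∈ Set.Icc (0 : ℝ) 1
  apply_zero : ∀ k, f k 0 = 0
  apply_one : ∀ k, f k 1 = 1
  ordered : ∀ t ∈ Set.Icc (0 : ℝ) 1, ∀ k l : Fin (n + 1), k ≤ l → f l t ≤ f k t

/-- The normalizing time `t*` at which the coordinate-wise medians sum to `1`. -/
noncomputable def tStar {n m : ℕ} (f : Fin (n + 1) → ℝ → ℝ)
    (P : Fin n → Fin m → ℝ) : ℝ :=
  sInf {t | t ∈ Set.Icc (0 : ℝ) 1 ∧ ∑ j, phMed f P t j = 1}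

/-- The moving phantom mechanism `A^F` defined by the phantom family `f`. -/
noncomputable def AMP {n m : ℕ} (f : Fin (n + 1) → ℝ → ℝ)
    (P : Fin n → Fin m → ℝ) : Fin m → ℝ :=
  fun j => phMed f P (tStar f P) j

/-- The independent-markets phantom system for `n` voters: `f k t = min (t(n-k)) 1`. -/
noncomputable def fIM (n : ℕ) : Fin (n + 1) → ℝ → ℝ :=
  fun k t => min (t * ((n : ℝ) - (k : ℝ))) 1

/-- The phantom system `F*` for `n` voters, in which the phantoms move to 1 one at a time. -/
noncomputable def fStar (n : ℕ) : Fin (n + 1) → ℝ → ℝ :=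
  fun k t => max 0 (min 1 (t * ((n : ℝ) + 1) - (k : ℝ)))

/-- The `j`-th standard unit vector in `ℝ^m`. -/
def unitVec (m : ℕ) (j : Fin m) : Fin m → ℝ := fun k => if k = j then 1 else 0

/-- Incentive compatibility under ℓ1 preferences. -/
def IncentiveCompatible {n m : ℕ} (A : (Fin n → Fin m → ℝ) → (Fin m → ℝ)) : Prop :=
  ∀ P : Fin n → Fin m → ℝ, IsProfile P → ∀ i : Fin n,
    ∀ ptrue pmis : Fin m → ℝ, IsDivision ptrue → IsDivision pmis →
      l1 (A (Function.update P i ptrue)) ptrue ≤ l1 (A (Function.update P i pmis)) ptrue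

/-- Anonymity: the output is invariant under permutations of the voters. -/
def Anonymous {n m : ℕ} (A : (Fin n → Fin m → ℝ) → (Fin m → ℝ)) : Prop :=
  ∀ P : Fin n → Fin m → ℝ, IsProfile P → ∀ σ : Equiv.Perm (Fin n), A (P ∘ σ) = A P

/-- Neutrality: permuting the alternatives in all reports permutes the output likewise. -/
def Neutral {n m : ℕ} (A : (Fin n → Fin m → ℝ) → (Fin m → ℝ)) : Prop :=
  ∀ P : Fin n → Fin m → ℝ, IsProfile P → ∀ σ : Equiv.Perm (Fin m),
    A (fun i j => P i (σ j)) = fun j => A P (σ j)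

/-- Proportionality: on single-minded profiles, alternative `j` gets `n_j / n`. -/
def Proportional {n m : ℕ} (A : (Fin n → Fin m → ℝ) → (Fin m → ℝ)) : Prop :=
  ∀ P : Fin n → Fin m → ℝ, (∀ i, ∃ j, P i = unitVec m j) →
    ∀ j, A P j = (Nat.card {i : Fin n // P i = unitVec m j} : ℝ) / (n : ℝ)

/-- Pareto optimality. -/
def ParetoOptimal {n m : ℕ} (A : (Fin n → Fin m → ℝ) → (Fin m → ℝ)) : Prop :=
  ∀ P : Fin n → Fin m → ℝ, IsProfile P → ∀ q : Fin m → ℝ, IsDivision q →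
    (∃ i, l1 q (P i) < l1 (A P) (P i)) → ∃ i, l1 (A P) (P i) < l1 q (P i)

/-- A mechanism is valid if it maps profiles to budget divisions. -/
def ValidMech {n m : ℕ} (A : (Fin n → Fin m → ℝ) → (Fin m → ℝ)) : Prop :=
  ∀ P, IsProfile P → IsDivision (A P)

/-- `q` maximizes (utilitarian) social welfare for `P`, i.e. minimizes total ℓ1 distance. -/
def MaximizesWelfare {n m : ℕ} (P : Fin n → Fin m → ℝ) (q : Fin m → ℝ) : Prop :=
  IsDivision q ∧ ∀ q' : Fin m → ℝ, IsDivision q' → ∑ i, l1 (P i) q ≤ ∑ i, l1 (P i) q'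

/-- The `k`-th largest entry of `v` (1-indexed); `0` when `k > n`. -/
noncomputable def kthLargest {n : ℕ} (v : Fin n → ℝ) (k : ℕ) : ℝ :=
  (((Multiset.ofList (List.ofFn v)).sort (· ≤ ·)).reverse).getD (k - 1) 0

theorem sorted_getD_iff (s : List ℝ) (n : ℕ) (hs : s.Pairwise (· ≤ ·)) (hl : s.length = 2 * n + 1)
    (z : ℝ) : z ≤ s.getD n 0 ↔ n + 1 ≤ s.countP (fun x => decide (z ≤ x)) := by
  have hn : n < s.length := by omega
  rw [List.getD_eq_getElem _ _ hn]
  constructor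
  · intro h
    have h1 : (s.drop n).countP (fun x => decide (z ≤ x)) = (s.drop n).length := by
      rw [List.countP_eq_length]
      intro a ha
      obtain ⟨i, hi, rfl⟩ := List.mem_iff_getElem.1 ha
      rw [List.getElem_drop]
      simp only [decide_eq_true_eq]
      refine h.trans ?_
      rcases Nat.eq_zero_or_pos i with h0 | h0
      · subst h0; simp
      · exact List.pairwise_iff_getElem.1 hs _ _ _ _ (by omega)
    have h2 := (List.drop_sublist n s).countP_le (p := fun x => decide (z ≤ x))
    rw [h1, List.length_drop] at h2
    omega
  · intro h
    by_contra hc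
    push Not at hc
    have h1 : (s.take (n+1)).countP (fun x => decide (z ≤ x)) = 0 := by
      rw [List.countP_eq_zero]
      intro a ha
      obtain ⟨i, hi, rfl⟩ := List.mem_iff_getElem.1 ha
      rw [List.getElem_take]
      simp only [decide_eq_true_eq, not_le]
      refine lt_of_le_of_lt ?_ hc
      rw [List.length_take] at hi
      rcases Nat.lt_or_ge i n with h0 | h0
      · exact List.pairwise_iff_getElem.1 hs _ _ _ _ h0
      · have : i = n := by omega
        subst this; exact le_rfl
    have h2 := List.countP_le_length (p := fun x => decide (z ≤ x)) (l := s.drop (n+1))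
    rw [List.length_drop] at h2
    rw [← List.take_append_drop (n+1) s, List.countP_append, h1] at h
    omega

theorem countP_ofFn_card {n : ℕ} (v : Fin n → ℝ) (z : ℝ) :
    (List.ofFn v).countP (fun x => decide (z ≤ x)) = (univ.filter (fun i => z ≤ v i)).card := by
  rw [List.ofFn_eq_map, List.countP_map, Finset.card_def, Finset.filter_val, ← Multiset.countP_eq_card_filter]
  rfl

theorem le_med_iff {n : ℕ} (v : Fin (n+1) → ℝ) (w : Fin n → ℝ) (z : ℝ) :
    z ≤ medList (List.ofFn v ++ List.ofFn w) ↔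
      n + 1 ≤ (univ.filter (fun i => z ≤ v i)).card + (univ.filter (fun i => z ≤ w i)).card := by
  unfold medList
  have h1 : ((List.ofFn v ++ List.ofFn w).length - 1) / 2 = n := by
    simp only [List.length_append, List.length_ofFn]; omega
  rw [h1, sorted_getD_iff _ n (Multiset.pairwise_sort _ _) (by
    rw [Multiset.length_sort]; simp; omega)]
  have : (Multiset.sort (↑(List.ofFn v ++ List.ofFn w) : Multiset ℝ) (· ≤ ·)).Perm
      (List.ofFn v ++ List.ofFn w) := by
    rw [← Multiset.coe_eq_coe, Multiset.sort_eq]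
  rw [this.countP_eq, List.countP_append, countP_ofFn_card, countP_ofFn_card]

theorem le_phMed_iff {n m : ℕ} (f : Fin (n + 1) → ℝ → ℝ) (P : Fin n → Fin m → ℝ) (t : ℝ)
    (j : Fin m) (z : ℝ) : z ≤ phMed f P t j ↔
      n + 1 ≤ (univ.filter (fun i => z ≤ f i t)).card
        + (univ.filter (fun i => z ≤ P i j)).card := le_med_iff _ _ _

theorem phMed_sub_le {n m : ℕ} (f : Fin (n + 1) → ℝ → ℝ) (P : Fin n → Fin m → ℝ) (s t e : ℝ)
    (he : 0 ≤ e) (h : ∀ i, f i s - e ≤ f i t) (j : Fin m) :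
    phMed f P s j - e ≤ phMed f P t j := by
  rw [le_phMed_iff]
  refine ((le_phMed_iff f P s j _).1 le_rfl).trans ?_
  refine Nat.add_le_add (Finset.card_le_card ?_) (Finset.card_le_card ?_)
  · intro i hi
    simp only [Finset.mem_filter, mem_univ, true_and] at hi ⊢
    linarith [h i]
  · intro i hi
    simp only [Finset.mem_filter, mem_univ, true_and] at hi ⊢
    linarith

theorem fStar_nonneg (n : ℕ) (i : Fin (n+1)) (t : ℝ) : 0 ≤ fStar n i t := le_max_left _ _
theorem fStar_le_one (n : ℕ) (i : Fin (n+1)) (t : ℝ) : fStar n i t ≤ 1 :=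
  max_le zero_le_one (min_le_left _ _)

theorem clamp_lip (a b e : ℝ) (he : 0 ≤ e) (h : a - e ≤ b) :
    max 0 (min 1 a) - e ≤ max 0 (min 1 b) := by
  rcases max_cases 0 (min 1 a) with h1 | h1 <;> rcases max_cases 0 (min 1 b) with h2 | h2 <;>
  rcases min_cases 1 a with h3 | h3 <;> rcases min_cases 1 b with h4 | h4 <;> linarith

theorem clamp_mono {a b : ℝ} (h : a ≤ b) : max 0 (min 1 a) ≤ max 0 (min 1 b) :=
  max_le_max le_rfl (min_le_min le_rfl h)

theorem phMed_mono {n m : ℕ} (P : Fin n → Fin m → ℝ) {s t : ℝ} (h : s ≤ t) (j : Fin m) :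
    phMed (fStar n) P s j ≤ phMed (fStar n) P t j := by
  have := phMed_sub_le (fStar n) P s t 0 le_rfl (fun i => by
    rw [sub_zero]
    apply clamp_mono
    gcongr) j
  linarith

theorem phMed_cont {n m : ℕ} (P : Fin n → Fin m → ℝ) (j : Fin m) :
    Continuous (fun t => phMed (fStar n) P t j) := by
  have key : ∀ s t : ℝ, phMed (fStar n) P s j - ((n:ℝ)+1) * |s - t| ≤ phMed (fStar n) P t j := by
    intro s t
    apply phMed_sub_le _ _ _ _ _ (by positivity)
    intro i
    apply clamp_lip _ _ _ (by positivity)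
    nlinarith [le_abs_self (s - t), (Nat.cast_nonneg n : (0:ℝ) ≤ n)]
  apply LipschitzWith.continuous (K := (n:NNReal)+1)
  apply LipschitzWith.of_dist_le_mul
  intro s t
  rw [Real.dist_eq, Real.dist_eq, abs_le]
  have h1 := key s t
  have h2 := key t s
  rw [abs_sub_comm t s] at h2
  push_cast
  constructor <;> linarith

theorem sum_cont {n m : ℕ} (P : Fin n → Fin m → ℝ) :
    Continuous (fun t => ∑ j, phMed (fStar n) P t j) :=
  continuous_finsetSum _ (fun j _ => phMed_cont P j)

theorem phMed_zero {n m : ℕ} (P : Fin n → Fin m → ℝ) (j : Fin m) :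
    phMed (fStar n) P 0 j ≤ 0 := by
  by_contra hc
  push Not at hc
  have h := (le_phMed_iff (fStar n) P 0 j _).1 le_rfl
  have h1 : (univ.filter (fun i => phMed (fStar n) P 0 j ≤ fStar n i 0)).card = 0 := by
    rw [Finset.card_eq_zero, Finset.filter_eq_empty_iff]
    intro i _
    have : fStar n i 0 ≤ 0 := by
      apply max_le le_rfl
      refine (min_le_right _ _).trans ?_
      have : (0:ℝ) ≤ ((i:ℕ):ℝ) := Nat.cast_nonneg _
      linarith
    linarith
  have h2 := Finset.card_filter_le (univ : Finset (Fin n)) (fun i => phMed (fStar n) P 0 j ≤ P i j)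
  rw [Finset.card_univ, Fintype.card_fin] at h2
  omega

theorem phMed_one {n m : ℕ} (P : Fin n → Fin m → ℝ) (j : Fin m) :
    1 ≤ phMed (fStar n) P 1 j := by
  rw [le_phMed_iff]
  have h1 : (univ.filter (fun i => 1 ≤ fStar n i 1)).card = n + 1 := by
    rw [Finset.filter_true_of_mem, Finset.card_univ, Fintype.card_fin]
    intro i _
    refine le_max_of_le_right (le_min le_rfl ?_)
    have : ((i:ℕ):ℝ) ≤ n := by exact_mod_cast Nat.lt_succ_iff.1 i.2
    linarith
  omega

theorem tStar_spec {n m : ℕ} (hm : 2 ≤ m) (P : Fin n → Fin m → ℝ) :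
    tStar (fStar n) P ∈ Set.Icc (0:ℝ) 1 ∧ ∑ j, phMed (fStar n) P (tStar (fStar n) P) j = 1 := by
  have hc : IsClosed {t | t ∈ Set.Icc (0 : ℝ) 1 ∧ ∑ j, phMed (fStar n) P t j = 1} :=
    isClosed_Icc.inter (isClosed_eq (sum_cont P) continuous_const)
  refine hc.csInf_mem ?_ ⟨0, fun t ht => ht.1.1⟩
  have h0 : ∑ j, phMed (fStar n) P 0 j ≤ 1 :=
    (Finset.sum_nonpos (fun j _ => phMed_zero P j)).trans zero_le_one
  have h1 : 1 ≤ ∑ j, phMed (fStar n) P 1 j := by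
    calc (1:ℝ) ≤ m := by exact_mod_cast (by omega : 1 ≤ m)
      _ = ∑ _j : Fin m, (1:ℝ) := by simp
      _ ≤ _ := Finset.sum_le_sum (fun j _ => phMed_one P j)
  obtain ⟨t, ht, h⟩ := intermediate_value_Icc (zero_le_one) (sum_cont P).continuousOn ⟨h0, h1⟩
  exact ⟨t, ht, h⟩

theorem eq_of_sum {n m : ℕ} (P : Fin n → Fin m → ℝ) {s t : ℝ}
    (h : ∑ j, phMed (fStar n) P s j = ∑ j, phMed (fStar n) P t j) (j : Fin m) :
    phMed (fStar n) P s j = phMed (fStar n) P t j := by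
  rcases le_total s t with hst | hst
  · exact (Finset.sum_eq_sum_iff_of_le (fun j _ => phMed_mono P hst j)).1 h j (mem_univ j)
  · exact ((Finset.sum_eq_sum_iff_of_le (fun j _ => phMed_mono P hst j)).1 h.symm j
      (mem_univ j)).symm

theorem card_filt_cons {n : ℕ} (q : Fin (n+1) → Prop) [DecidablePred q] :
    (univ.filter q).card = (if q 0 then 1 else 0) + (univ.filter (fun i : Fin n => q i.succ)).card := by
  simp only [Finset.card_filter]
  rw [Fin.sum_univ_succ]

theorem card_snoc {n : ℕ} (q : Fin (n+1) → Prop) [DecidablePred q] :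
    (univ.filter q).card = (univ.filter (fun i : Fin n => q i.castSucc)).card +
      (if q (Fin.last n) then 1 else 0) := by
  simp only [Finset.card_filter]
  rw [Fin.sum_univ_castSucc]

theorem card_votes {k m : ℕ} (P : Fin k → Fin m → ℝ) (p : Fin m → ℝ) (j : Fin m) (z : ℝ) :
    (univ.filter (fun i => z ≤ (Fin.cons p P : Fin (k+1) → Fin m → ℝ) i j)).card =
      (if z ≤ p j then 1 else 0) + (univ.filter (fun i => z ≤ P i j)).card := by
  rw [card_filt_cons]
  simp only [Fin.cons_zero, Fin.cons_succ]

/-- the mechanism `A^{F*}` satisfies participation (here `k = n - 1 ≥ 1`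
voters are already present). -/
theorem fstar_participation (m k : ℕ) (hm : 2 ≤ m) (hk : 1 ≤ k)
    (P : Fin k → Fin m → ℝ) (hP : IsProfile P)
    (p : Fin m → ℝ) (hp : IsDivision p) :
    l1 (AMP (fStar (k + 1)) (Fin.cons p P)) p ≤ l1 (AMP (fStar k) P) p := by
  set P' : Fin (k+1) → Fin m → ℝ := Fin.cons p P with hP'
  obtain ⟨⟨ht0, ht1⟩, hsum⟩ := tStar_spec hm P
  obtain ⟨-, hsum'⟩ := tStar_spec hm P'
  set t := tStar (fStar k) P with ht
  have hk0 : (0:ℝ) ≤ k := Nat.cast_nonneg k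
  have hk2 : (0:ℝ) < (k:ℝ) + 2 := by linarith
  set x : ℝ := t * ((k:ℝ) + 1) with hx
  have hx1 : x ≤ k + 1 := by rw [hx]; nlinarith
  have fk : ∀ i : Fin (k+1), fStar k i t = max 0 (min 1 (x - (i:ℕ))) := fun i => rfl
  have fk' : ∀ (y : ℝ) (i : Fin (k+2)), fStar (k+1) i (y / ((k:ℝ)+2)) =
      max 0 (min 1 (y - (i:ℕ))) := by
    intro y i
    unfold fStar
    push_cast
    congr 3
    field_simp
    ring
  -- lower comparison
  have hlow : ∀ j, phMed (fStar (k+1)) P' (x / ((k:ℝ)+2)) j ≤ phMed (fStar k) P t j := by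
    intro j
    have h := (le_phMed_iff (fStar (k+1)) P' (x / ((k:ℝ)+2)) j _).1 le_rfl
    set z := phMed (fStar (k+1)) P' (x / ((k:ℝ)+2)) j
    rw [le_phMed_iff]
    rcases le_or_gt z 0 with hz | hz
    · have : (univ.filter (fun i => z ≤ fStar k i t)).card = k + 1 := by
        rw [Finset.filter_true_of_mem, Finset.card_univ, Fintype.card_fin]
        intro i _
        exact hz.trans (fStar_nonneg _ _ _)
      omega
    · rw [card_votes, card_snoc, if_neg] at h
      · simp only [fk', Fin.val_castSucc] at h
        simp only [fk]
        split_ifs at h <;> omega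
      · rw [fk', not_le]
        refine lt_of_le_of_lt (max_le le_rfl ((min_le_right _ _).trans ?_)) hz
        simp only [Fin.val_last]
        push_cast
        linarith
  have hhigh : ∀ j, phMed (fStar k) P t j ≤ phMed (fStar (k+1)) P' ((x+1) / ((k:ℝ)+2)) j := by
    intro j
    have h := (le_phMed_iff (fStar k) P t j _).1 le_rfl
    set z := phMed (fStar k) P t j
    have hz : z ≤ 1 := by
      by_contra hc
      push Not at hc
      have h1 : (univ.filter (fun i => z ≤ fStar k i t)).card = 0 := by
        rw [Finset.card_eq_zero, Finset.filter_eq_empty_iff]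
        intro i _
        linarith [fStar_le_one k i t]
      have h2 := Finset.card_filter_le (univ : Finset (Fin k)) (fun i => z ≤ P i j)
      rw [Finset.card_univ, Fintype.card_fin] at h2
      omega
    rw [le_phMed_iff, card_votes, card_filt_cons, if_pos]
    · simp only [fk', Fin.val_succ]
      simp only [fk] at h
      push_cast
      simp only [add_sub_add_right_eq_sub]
      omega
    · rw [fk']
      refine hz.trans (le_max_of_le_right (le_min le_rfl ?_))
      have : 0 ≤ x := by positivity
      simp only [Fin.val_zero]
      push_cast
      linarith
  -- time for the enlarged profile
  obtain ⟨t', ⟨h1, h2⟩, hs⟩ := intermediate_value_Icc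
    (by gcongr; linarith : x / ((k:ℝ)+2) ≤ (x+1) / ((k:ℝ)+2)) (sum_cont P').continuousOn
    ⟨(Finset.sum_le_sum (fun j _ => hlow j)).trans hsum.le,
      hsum.ge.trans (Finset.sum_le_sum (fun j _ => hhigh j))⟩
  obtain ⟨y, rfl⟩ : ∃ y, t' = y / ((k:ℝ)+2) := ⟨t' * (k+2), by field_simp⟩
  rw [div_le_div_iff_of_pos_right hk2] at h1 h2
  have hq : ∀ j, AMP (fStar (k+1)) P' j = phMed (fStar (k+1)) P' (y / ((k:ℝ)+2)) j :=
    fun j => eq_of_sum P' (hsum'.trans hs.symm) j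
  unfold l1
  refine Finset.sum_le_sum (fun j _ => ?_)
  rw [hq]
  change _ ≤ |phMed (fStar k) P t j - p j|
  have hmin : min (phMed (fStar k) P t j) (p j) ≤ phMed (fStar (k+1)) P' (y / ((k:ℝ)+2)) j := by
    have h := (le_phMed_iff (fStar k) P t j _).1 (min_le_left _ (p j))
    have hzp := min_le_right (phMed (fStar k) P t j) (p j)
    set z := min (phMed (fStar k) P t j) (p j)
    rw [le_phMed_iff, card_votes, if_pos hzp, card_snoc]
    have : (univ.filter (fun i => z ≤ fStar k i t)).card ≤
        (univ.filter (fun i : Fin (k+1) => z ≤ fStar (k+1) i.castSucc (y / ((k:ℝ)+2)))).card := by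
      apply Finset.card_le_card
      intro i hi
      simp only [Finset.mem_filter, mem_univ, true_and] at hi ⊢
      refine hi.trans ?_
      rw [fk, fk']
      apply clamp_mono
      simp only [Fin.val_castSucc]
      linarith
    omega
  have hmax : phMed (fStar (k+1)) P' (y / ((k:ℝ)+2)) j ≤ max (phMed (fStar k) P t j) (p j) := by
    by_contra hc
    push Not at hc
    obtain ⟨hc1, hc2⟩ := max_lt_iff.1 hc
    have h := (le_phMed_iff (fStar (k+1)) P' (y / ((k:ℝ)+2)) j _).1 le_rfl
    set z := phMed (fStar (k+1)) P' (y / ((k:ℝ)+2)) j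
    rw [← not_le, le_phMed_iff] at hc1
    rw [card_votes, if_neg (not_le.2 hc2), card_filt_cons] at h
    have : (univ.filter (fun i : Fin (k+1) => z ≤ fStar (k+1) i.succ (y / ((k:ℝ)+2)))).card ≤
        (univ.filter (fun i => z ≤ fStar k i t)).card := by
      apply Finset.card_le_card
      intro i hi
      simp only [Finset.mem_filter, mem_univ, true_and] at hi ⊢
      refine hi.trans ?_
      rw [fk, fk']
      apply clamp_mono
      simp only [Fin.val_succ]
      push_cast
      linarith
    split_ifs at h <;> omega
  rcases le_total (phMed (fStar k) P t j) (p j) with h | h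
  · rw [min_eq_left h] at hmin
    rw [max_eq_right h] at hmax
    rw [abs_of_nonpos (by linarith), abs_of_nonpos (by linarith)]
    linarith
  · rw [min_eq_right h] at hmin
    rw [max_eq_left h] at hmax
    rw [abs_of_nonneg (by linarith), abs_of_nonneg (by linarith)]
    linarith
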